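/- arXiv:1411.4418 — 2 statements merged into one kernel-verified Lean document; each statement's English description precedes it below -/
import Mathlib

section
/- Let R be a ring and M a left R-module. Then Gen(M) equals the class of all left R-modules X with Ext^1_R(M, X) = 0 if and only if M is a classical tilting module, i.e.: (i) M has projective dimension at most 1; (ii) Ext^1_R(M, M^(I)) = 0 for every direct sum M^(I) of copies of M; and (iii) there is a short exact sequence 0 → R → M' → M'' → 0 of left R-modules with M' and M'' in Add(M). -/
open CategoryTheory

universe u

noncomputable section

variable (R : Type u) [Ring R]

/-- `Ext^n_R(M, N) = 0`. -/
def ExtVanish (M N : ModuleCat.{u} R) (n : ℕ) : Prop :=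
  Subsingleton (((Ext ℤ (ModuleCat.{u} R) n).obj (Opposite.op M)).obj N)

/-- `N ∈ Add M`: `N` is a direct summand of a direct sum of copies of `M`. -/
def InAdd (M N : ModuleCat.{u} R) : Prop :=
  ∃ (ι : Type u) (s : N ⟶ ModuleCat.of R (ι →₀ M)) (r : ModuleCat.of R (ι →₀ M) ⟶ N),
    s ≫ r = 𝟙 N

/-- `X ∈ Gen(M)`: `X` is an epimorphic image of some member of `Add M`. -/
def InGen (M X : ModuleCat.{u} R) : Prop :=
  ∃ (N : ModuleCat.{u} R) (f : N ⟶ X), InAdd R M N ∧ Function.Surjective f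

/-- In positive degrees, vanishing of the derived-functor `Ext` agrees with vanishing of the
`Ext` defined via the derived category. -/
theorem extVanish_succ_iff (M X : ModuleCat.{u} R) (n : ℕ) :
    ExtVanish R M X (n + 1) ↔ Subsingleton (Abelian.Ext.{u} M X (n + 1)) := by
  let P := ProjectiveResolution.of M
  have h₁ : ExtVanish R M X (n + 1) ↔
      ((P.complex.linearYonedaObj ℤ X).sc' n (n + 1) (n + 2)).Exact := by
    rw [← HomologicalComplex.exactAt_iff' _ _ _ _ (by simp) (by simp),
      HomologicalComplex.exactAt_iff_isZero_homology,
      ← (P.isoExt (R := ℤ) (n + 1) X).isZero_iff, ModuleCat.isZero_iff_subsingleton]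
    rfl
  rw [h₁, ShortComplex.moduleCat_exact_iff]
  constructor
  · intro h
    refine subsingleton_of_forall_eq 0 fun α ↦ ?_
    obtain ⟨f, hf, rfl⟩ := P.extMk_surjective α (n + 2) rfl
    rw [P.extMk_eq_zero_iff f _ _ _ n rfl]
    exact h f hf
  · intro h f hf
    exact (P.extMk_eq_zero_iff f (n + 2) rfl hf n rfl).1 (Subsingleton.elim _ _)

section

variable {R}

theorem exists_lift_of_ext {S : ShortComplex (ModuleCat.{u} R)} (hS : S.ShortExact)
    {A : ModuleCat.{u} R} (h : ExtVanish R A S.X₁ 1) (φ : A ⟶ S.X₃) :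
    ∃ ψ : A ⟶ S.X₂, ψ ≫ S.g = φ := by
  rw [extVanish_succ_iff] at h
  obtain ⟨x, hx⟩ := Abelian.Ext.covariant_sequence_exact₃ A hS (Abelian.Ext.mk₀ φ) (zero_add 1)
    (Subsingleton.elim _ _)
  obtain ⟨ψ, rfl⟩ := Abelian.Ext.homEquiv₀.symm.surjective x
  refine ⟨ψ, Abelian.Ext.homEquiv₀.symm.injective ?_⟩
  simpa using hx

theorem exists_extension_of_ext {S : ShortComplex (ModuleCat.{u} R)} (hS : S.ShortExact)
    {B : ModuleCat.{u} R} (h : ExtVanish R S.X₃ B 1) (φ : S.X₁ ⟶ B) :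
    ∃ ψ : S.X₂ ⟶ B, S.f ≫ ψ = φ := by
  rw [extVanish_succ_iff] at h
  obtain ⟨x, hx⟩ := Abelian.Ext.contravariant_sequence_exact₁ hS B (Abelian.Ext.mk₀ φ)
    (add_zero 1) (Subsingleton.elim _ _)
  obtain ⟨ψ, rfl⟩ := Abelian.Ext.homEquiv₀.symm.surjective x
  refine ⟨ψ, Abelian.Ext.homEquiv₀.symm.injective ?_⟩
  simpa using hx

theorem extVanish_of_lift {S : ShortComplex (ModuleCat.{u} R)} (hS : S.ShortExact)
    {A : ModuleCat.{u} R} (h : ExtVanish R A S.X₂ 1)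
    (hl : ∀ φ : A ⟶ S.X₃, ∃ ψ : A ⟶ S.X₂, ψ ≫ S.g = φ) : ExtVanish R A S.X₁ 1 := by
  rw [extVanish_succ_iff] at h ⊢
  refine subsingleton_of_forall_eq 0 fun α ↦ ?_
  obtain ⟨x, rfl⟩ := Abelian.Ext.covariant_sequence_exact₁ A hS α (Subsingleton.elim _ _)
    (zero_add 1)
  obtain ⟨φ, rfl⟩ := Abelian.Ext.homEquiv₀.symm.surjective x
  obtain ⟨ψ, rfl⟩ := hl φ
  simp [← Abelian.Ext.mk₀_comp_mk₀]

theorem extVanish_injective (A I : ModuleCat.{u} R) [Injective I] (n : ℕ) :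
    ExtVanish R A I (n + 1) :=
  (extVanish_succ_iff R A I n).2 (Abelian.Ext.subsingleton_of_injective A I n)

theorem extVanish_projective (A I : ModuleCat.{u} R) [Projective A] (n : ℕ) :
    ExtVanish R A I (n + 1) :=
  (extVanish_succ_iff R A I n).2 (Abelian.Ext.subsingleton_of_projective A I n)

theorem extVanish_X₂ {S : ShortComplex (ModuleCat.{u} R)} (hS : S.ShortExact)
    {A : ModuleCat.{u} R} (h₁ : ExtVanish R A S.X₁ 1) (h₃ : ExtVanish R A S.X₃ 1) :
    ExtVanish R A S.X₂ 1 := by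
  rw [extVanish_succ_iff] at h₁ h₃ ⊢
  refine subsingleton_of_forall_eq 0 fun α ↦ ?_
  obtain ⟨x, rfl⟩ := Abelian.Ext.covariant_sequence_exact₂ A hS α (Subsingleton.elim _ _)
  rw [Subsingleton.elim x 0, Abelian.Ext.zero_comp]

theorem extVanish_contravariant_X₂ {S : ShortComplex (ModuleCat.{u} R)} (hS : S.ShortExact)
    {B : ModuleCat.{u} R} (h₁ : ExtVanish R S.X₁ B 1) (h₃ : ExtVanish R S.X₃ B 1) :
    ExtVanish R S.X₂ B 1 := by
  rw [extVanish_succ_iff] at h₁ h₃ ⊢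
  refine subsingleton_of_forall_eq 0 fun α ↦ ?_
  obtain ⟨x, rfl⟩ := Abelian.Ext.contravariant_sequence_exact₂ hS B α (Subsingleton.elim _ _)
  rw [Subsingleton.elim x 0, Abelian.Ext.comp_zero]

theorem extVanish_X₃ {S : ShortComplex (ModuleCat.{u} R)} (hS : S.ShortExact)
    {A : ModuleCat.{u} R} {n : ℕ} (h₂ : ExtVanish R A S.X₂ (n + 1))
    (h₁ : ExtVanish R A S.X₁ (n + 2)) : ExtVanish R A S.X₃ (n + 1) := by
  rw [extVanish_succ_iff] at h₁ h₂ ⊢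
  refine subsingleton_of_forall_eq 0 fun α ↦ ?_
  obtain ⟨x, rfl⟩ := Abelian.Ext.covariant_sequence_exact₃ A hS α rfl (Subsingleton.elim _ _)
  rw [Subsingleton.elim x 0, Abelian.Ext.zero_comp]

theorem extVanish_X₁ {S : ShortComplex (ModuleCat.{u} R)} (hS : S.ShortExact)
    {A : ModuleCat.{u} R} {n : ℕ} (h₂ : ExtVanish R A S.X₂ (n + 2))
    (h₃ : ExtVanish R A S.X₃ (n + 1)) : ExtVanish R A S.X₁ (n + 2) := by
  rw [extVanish_succ_iff] at h₂ h₃ ⊢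
  refine subsingleton_of_forall_eq 0 fun α ↦ ?_
  obtain ⟨x, rfl⟩ := Abelian.Ext.covariant_sequence_exact₁ A hS α (Subsingleton.elim _ _) rfl
  rw [Subsingleton.elim x 0, Abelian.Ext.zero_comp]

theorem extVanish_iff_lift {I A X : ModuleCat.{u} R} [Injective I] (i : X ⟶ I) [Mono i] :
    ExtVanish R A X 1 ↔
      ∀ φ : A ⟶ Limits.cokernel i, ∃ ψ : A ⟶ I, ψ ≫ Limits.cokernel.π i = φ := by
  let S := ShortComplex.mk i (Limits.cokernel.π i) (Limits.cokernel.condition i)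
  have hS : S.ShortExact := { exact := ShortComplex.exact_cokernel i }
  exact ⟨exists_lift_of_ext hS, extVanish_of_lift hS (extVanish_injective A I 0)⟩

theorem extVanish_finsupp {M X : ModuleCat.{u} R} (h : ExtVanish R M X 1) (ι : Type u) :
    ExtVanish R (ModuleCat.of R (ι →₀ M)) X 1 := by
  rw [extVanish_iff_lift (Injective.ι X)] at h ⊢
  intro φ
  choose ψ hψ using fun j : ι ↦ h (ModuleCat.ofHom (Finsupp.lsingle j) ≫ φ)
  refine ⟨ModuleCat.ofHom (Finsupp.lsum ℕ fun j ↦ (ψ j).hom), ?_⟩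
  ext : 1
  refine Finsupp.lhom_ext fun j m ↦ ?_
  refine Eq.trans ?_ congr($(hψ j) m)
  change (Limits.cokernel.π (Injective.ι X)).hom
    (Finsupp.lsum ℕ (fun j ↦ (ψ j).hom) (Finsupp.single j m)) = _
  rw [Finsupp.lsum_single]
  rfl

theorem extVanish_of_inAdd {M N X : ModuleCat.{u} R} (hN : InAdd R M N)
    (h : ExtVanish R M X 1) : ExtVanish R N X 1 := by
  obtain ⟨ι, s, r, hsr⟩ := hN
  have h' := extVanish_finsupp h ι
  rw [extVanish_succ_iff] at h' ⊢
  refine subsingleton_of_forall_eq 0 fun α ↦ ?_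
  rw [← Abelian.Ext.mk₀_id_comp α, ← hsr, ← Abelian.Ext.mk₀_comp_mk₀_assoc,
    Subsingleton.elim ((Abelian.Ext.mk₀ r).comp α _) 0, Abelian.Ext.comp_zero]

theorem extVanish_right_of_inAdd {A M N : ModuleCat.{u} R} (hN : InAdd R M N)
    (h : ∀ ι : Type u, ExtVanish R A (ModuleCat.of R (ι →₀ M)) 1) : ExtVanish R A N 1 := by
  obtain ⟨ι, s, r, hsr⟩ := hN
  have h' := h ι
  rw [extVanish_succ_iff] at h' ⊢
  refine subsingleton_of_forall_eq 0 fun α ↦ ?_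
  rw [← Abelian.Ext.comp_mk₀_id α, ← hsr, ← Abelian.Ext.mk₀_comp_mk₀,
    ← Abelian.Ext.comp_assoc_of_second_deg_zero,
    Subsingleton.elim (α.comp (Abelian.Ext.mk₀ s) _) 0, Abelian.Ext.zero_comp]

theorem shortExact_mk {A B C : ModuleCat.{u} R} (f : A ⟶ B) (g : B ⟶ C)
    (hf : Function.Injective f) (hg : Function.Surjective g) (h : Function.Exact f g) :
    ∃ w : f ≫ g = 0, (ShortComplex.mk f g w).ShortExact := by
  have w : f ≫ g = 0 := by
    ext x
    exact h.apply_apply_eq_zero x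
  exact ⟨w,
    { exact := (ShortComplex.moduleCat_exact_iff _).2 fun x hx ↦ (h x).1 hx
      mono_f := (ModuleCat.mono_iff_injective f).2 hf
      epi_g := (ModuleCat.epi_iff_surjective g).2 hg }⟩

/-- The evaluation map from the direct sum of copies of `M` indexed by `M ⟶ X`. -/
def traceMap (M X : ModuleCat.{u} R) : ModuleCat.of R ((M ⟶ X) →₀ M) ⟶ X :=
  ModuleCat.ofHom (Finsupp.lsum ℕ fun φ : M ⟶ X ↦ φ.hom)

theorem traceMap_single {M X : ModuleCat.{u} R} (φ : M ⟶ X) (m : M) :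
    traceMap M X (Finsupp.single φ m) = φ m :=
  Finsupp.lsum_single ℕ _ _ _

theorem exists_comp_traceMap {M X : ModuleCat.{u} R} {ι : Type u}
    (φ : ModuleCat.of R (ι →₀ M) ⟶ X) : ∃ θ, θ ≫ traceMap M X = φ := by
  refine ⟨ModuleCat.ofHom (Finsupp.lmapDomain M R
    fun j ↦ ModuleCat.ofHom (Finsupp.lsingle j) ≫ φ), ?_⟩
  ext : 1
  refine Finsupp.lhom_ext fun j m ↦ ?_
  change traceMap M X (Finsupp.mapDomain _ (Finsupp.single j m)) = _
  rw [Finsupp.mapDomain_single, traceMap_single]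
  rfl

theorem inAdd_finsupp (M : ModuleCat.{u} R) (ι : Type u) :
    InAdd R M (ModuleCat.of R (ι →₀ M)) :=
  ⟨ι, 𝟙 _, 𝟙 _, Category.comp_id _⟩

theorem inGen_finsupp (M : ModuleCat.{u} R) (ι : Type u) :
    InGen R M (ModuleCat.of R (ι →₀ M)) :=
  ⟨_, 𝟙 _, inAdd_finsupp M ι, Function.surjective_id⟩

theorem InGen.of_surjective {M X Y : ModuleCat.{u} R} (h : InGen R M X) (f : X ⟶ Y)
    (hf : Function.Surjective f) : InGen R M Y := by
  obtain ⟨N, g, hN, hg⟩ := h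
  exact ⟨N, g ≫ f, hN, by simpa using hf.comp hg⟩

theorem InAdd.exists_traceMap_eq {M N X : ModuleCat.{u} R} (hN : InAdd R M N) (φ : N ⟶ X) (n : N) :
    ∃ y, traceMap M X y = φ n := by
  obtain ⟨ι, s, r, hsr⟩ := hN
  obtain ⟨θ, hθ⟩ := exists_comp_traceMap (r ≫ φ)
  refine ⟨θ (s n), ?_⟩
  have h₁ : (θ ≫ traceMap M X) (s n) = (r ≫ φ) (s n) := by rw [hθ]
  have h₂ : (s ≫ r) n = n := by rw [hsr]; rfl
  exact h₁.trans (congrArg φ h₂)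

theorem inGen_iff_surjective_traceMap {M X : ModuleCat.{u} R} :
    InGen R M X ↔ Function.Surjective (traceMap M X) := by
  refine ⟨fun ⟨N, f, hN, hf⟩ x ↦ ?_, fun h ↦ ⟨_, _, inAdd_finsupp M _, h⟩⟩
  obtain ⟨n, rfl⟩ := hf x
  exact hN.exists_traceMap_eq f n

theorem inGen_of_extVanish {M M' M'' X : ModuleCat.{u} R} (f : ModuleCat.of R R ⟶ M')
    (g : M' ⟶ M'') (h' : InAdd R M M') (h'' : InAdd R M M'') (hf : Function.Injective f)
    (hg : Function.Surjective g) (hfg : Function.Exact f g) (hX : ExtVanish R M X 1) :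
    InGen R M X := by
  rw [inGen_iff_surjective_traceMap]
  intro x
  obtain ⟨w, hS⟩ := shortExact_mk f g hf hg hfg
  obtain ⟨ψ, hψ⟩ := exists_extension_of_ext hS (extVanish_of_inAdd h'' hX)
    (ModuleCat.ofHom (LinearMap.toSpanSingleton R X x))
  obtain ⟨y, hy⟩ := h'.exists_traceMap_eq ψ (f (1 : R))
  refine ⟨y, hy.trans ?_⟩
  have h : (f ≫ ψ) (1 : R) = ModuleCat.ofHom (LinearMap.toSpanSingleton R X x) (1 : R) := by
    rw [← hψ]
  exact h.trans (one_smul R x)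

/-- Every module `A` embeds, with cokernel a direct sum of copies of `M`, into a module `E` with
`Ext¹(M, E) = 0`. -/
theorem exists_extension (M A : ModuleCat.{u} R)
    (h : ∀ ι : Type u, ExtVanish R M (ModuleCat.of R (ι →₀ M)) 1) :
    ∃ (E : ModuleCat.{u} R) (ι : Type u) (f : A ⟶ E) (g : E ⟶ ModuleCat.of R (ι →₀ M)),
      ExtVanish R M E 1 ∧ Function.Injective f ∧ Function.Surjective g ∧ Function.Exact f g := by
  let I := Injective.under A
  let i : A ⟶ I := Injective.ι A
  let C := Limits.cokernel i
  let π : I ⟶ C := Limits.cokernel.π i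
  have hi : Function.Injective i := (ModuleCat.mono_iff_injective i).1 inferInstance
  have hπ : Function.Surjective π := (ModuleCat.epi_iff_surjective π).1 inferInstance
  have hiπ (a : A) : π (i a) = 0 := congr($(Limits.cokernel.condition i) a)
  have hex (x : I) (hx : π x = 0) : ∃ a, i a = x :=
    (ShortComplex.moduleCat_exact_iff _).1 (ShortComplex.exact_cokernel i) x hx
  let F := ModuleCat.of R ((M ⟶ C) →₀ M)
  let e : F ⟶ C := traceMap M C
  let L : (I × F) →ₗ[R] C :=
    π.hom ∘ₗ LinearMap.fst R I F - e.hom ∘ₗ LinearMap.snd R I F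
  have hL (x : I) (y : F) : L (x, y) = π x - e y := rfl
  let E := LinearMap.ker L
  have hP : ExtVanish R M (ModuleCat.of R (I × F)) 1 := by
    obtain ⟨w, hS⟩ := shortExact_mk (ModuleCat.ofHom (LinearMap.inl R I F))
      (ModuleCat.ofHom (LinearMap.snd R I F)) LinearMap.inl_injective
      LinearMap.snd_surjective Function.Exact.inl_snd
    exact extVanish_X₂ hS (extVanish_injective M I 0) (h _)
  refine ⟨ModuleCat.of R E, M ⟶ C,
    ModuleCat.ofHom ((LinearMap.inl R I F ∘ₗ i.hom).codRestrict E fun a ↦ ?_),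
    ModuleCat.ofHom (LinearMap.snd R I F ∘ₗ E.subtype), ?_, ?_, ?_, ?_⟩
  · change L (i a, 0) = 0
    rw [hL, hiπ, map_zero, sub_zero]
  · obtain ⟨w, hS⟩ := shortExact_mk (ModuleCat.ofHom E.subtype)
      (ModuleCat.ofHom L) E.subtype_injective
      (fun c ↦ by
        obtain ⟨x, rfl⟩ := hπ c
        refine ⟨(x, 0), ?_⟩
        change L (x, 0) = _
        rw [hL, map_zero, sub_zero])
      (LinearMap.exact_subtype_ker_map L)
    refine extVanish_of_lift hS hP fun φ ↦
      ⟨ModuleCat.ofHom (LinearMap.inr R I F ∘ₗ (-Finsupp.lsingle φ)), ?_⟩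
    ext m
    change L (0, -Finsupp.single φ m) = _
    rw [hL, map_zero, map_neg, zero_sub, neg_neg]
    exact traceMap_single φ m
  · intro a b hab
    exact hi congr(($hab : I × F).1)
  · intro y
    obtain ⟨x, hx⟩ := hπ (e y)
    exact ⟨⟨(x, y), by change L (x, y) = 0; rw [hL, hx, sub_self]⟩, rfl⟩
  · rintro ⟨⟨x, y⟩, hxy⟩
    constructor
    · rintro (rfl : y = 0)
      obtain ⟨a, rfl⟩ := hex x (by
        change L (x, 0) = 0 at hxy
        rwa [hL, map_zero, sub_zero] at hxy)
      exact ⟨a, rfl⟩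
    · rintro ⟨a, ha⟩
      exact congr(($ha : I × F).2).symm

/-- A module in `Gen(M)` that is Ext-projective relative to the class `Ext¹(M, -) = 0`
belongs to `Add(M)`, because its trace map splits. -/
theorem inAdd_of_extVanish {M E : ModuleCat.{u} R} (hE : InGen R M E)
    (h : ∀ ι : Type u, ExtVanish R M (ModuleCat.of R (ι →₀ M)) 1)
    (hK : ∀ K : ModuleCat.{u} R, ExtVanish R M K 1 → ExtVanish R E K 1) : InAdd R M E := by
  have : Epi (traceMap M E) :=
    (ModuleCat.epi_iff_surjective _).2 (inGen_iff_surjective_traceMap.1 hE)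
  have hS : (ShortComplex.mk _ _ (Limits.kernel.condition (traceMap M E))).ShortExact :=
    { exact := ShortComplex.exact_kernel _ }
  obtain ⟨s, hs⟩ := exists_lift_of_ext hS (hK _ (extVanish_of_lift hS (h _) fun φ ↦
    ⟨ModuleCat.ofHom (Finsupp.lsingle φ), by ext m; exact traceMap_single φ m⟩)) (𝟙 E)
  exact ⟨_, s, traceMap M E, hs⟩

theorem extVanish_of_forall_two {M : ModuleCat.{u} R} (h : ∀ X, ExtVanish R M X 2)
    (X : ModuleCat.{u} R) (i : ℕ) (hi : 1 < i) : ExtVanish R M X i := by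
  have := hasProjectiveDimensionLT_of_enoughInjectives M 2
    fun Y ↦ (extVanish_succ_iff R M Y 1).1 (h Y)
  obtain ⟨k, rfl⟩ := Nat.exists_eq_add_of_lt hi
  exact (extVanish_succ_iff R M X _).2 (HasProjectiveDimensionLT.subsingleton M 2 _ (by lia) X)

end

/-- For a ring `R` and a left `R`-module `M`, the class `Gen(M)` coincides
with `Ker Ext¹_R(M, -)` if and only if `M` is a classical tilting module, i.e.
(i) `M` has projective dimension at most `1` (equivalently, `Ext^i_R(M, -) = 0` for all `i > 1`);
(ii) `Ext¹_R(M, M^(I)) = 0` for every direct sum `M^(I)` of copies of `M`; and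
(iii) there is a short exact sequence `0 → R → M' → M'' → 0` with `M', M'' ∈ Add M`. -/
theorem gen_eq_ker_ext_iff_classical_tilting (M : ModuleCat.{u} R) :
    (∀ X : ModuleCat.{u} R, InGen R M X ↔ ExtVanish R M X 1) ↔
      ((∀ (X : ModuleCat.{u} R) (i : ℕ), 1 < i → ExtVanish R M X i) ∧
        (∀ ι : Type u, ExtVanish R M (ModuleCat.of R (ι →₀ M)) 1) ∧
        (∃ (M' M'' : ModuleCat.{u} R) (f : ModuleCat.of R R ⟶ M') (g : M' ⟶ M''),
          InAdd R M M' ∧ InAdd R M M'' ∧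
          Function.Injective f ∧ Function.Surjective g ∧ Function.Exact f g)) := by
  constructor
  · intro hG
    have hM (ι : Type u) : ExtVanish R M (ModuleCat.of R (ι →₀ M)) 1 :=
      (hG _).1 (inGen_finsupp M ι)
    refine ⟨extVanish_of_forall_two fun X ↦ ?_, hM, ?_⟩
    · have hS : (ShortComplex.mk _ _ (Limits.cokernel.condition (Injective.ι X))).ShortExact :=
        { exact := ShortComplex.exact_cokernel _ }
      refine extVanish_X₁ hS (extVanish_injective M _ 1) ((hG _).1 ?_)
      exact ((hG _).2 (extVanish_injective M (Injective.under X) 0)).of_surjective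
        (Limits.cokernel.π (Injective.ι X)) ((ModuleCat.epi_iff_surjective _).1 inferInstance)
    · obtain ⟨E, ι, f, g, hE, hf, hg, hfg⟩ := exists_extension M (ModuleCat.of R R) hM
      obtain ⟨w, hS⟩ := shortExact_mk f g hf hg hfg
      exact ⟨E, _, f, g, inAdd_of_extVanish ((hG E).2 hE) hM fun K hK ↦
        extVanish_contravariant_X₂ hS (extVanish_projective _ K 0) (extVanish_finsupp hK ι),
        inAdd_finsupp M ι, hf, hg, hfg⟩
  · rintro ⟨hpd, hM, M', M'', f, g, h', h'', hf, hg, hfg⟩ X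
    refine ⟨fun ⟨N, p, hN, hp⟩ ↦ ?_, inGen_of_extVanish f g h' h'' hf hg hfg⟩
    have : Epi p := (ModuleCat.epi_iff_surjective p).2 hp
    have hS : (ShortComplex.mk _ _ (Limits.kernel.condition p)).ShortExact :=
      { exact := ShortComplex.exact_kernel p }
    exact extVanish_X₃ hS (extVanish_right_of_inAdd hN hM) (hpd _ 2 one_lt_two)
end
end

section
/- Let K be a field, V := ⊕_{i∈ℕ} K a countably infinite-dimensional K-vector space regarded as a (K×K, K×K)-bimodule via (x,y)·v := y·v and v·(x,y) := x·v, and let A be the square-zero (trivial) extension of K×K by V, i.e., A = (K×K) ⊕ V with multiplication (s, v)(s', v') = (ss', s·v' + v·s'). Let e := ((1,0), 0) ∈ A and P := Ae, the indecomposable projective non-simple left A-module. Then the canonical evaluation map P → Hom_A(Hom_A(P, A), A) is bijective (P is reflexive with respect to the regular bimodule), but for the maximal submodule rad(A)·e = {0} ⊕ V of P the canonical evaluation map V → Hom_A(Hom_A(V, A), A) is not bijective (V is not reflexive). In particular, reflexive modules with respect to the faithfully balanced bimodule A over itself are not closed under submodules. -/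
noncomputable section

/-- The canonical evaluation map of a left `A`-module `M` into its double dual with respect
to the regular bimodule: `m ↦ (f ↦ f m)`.  Here the dual `Hom_A(M, A)` is a right `A`-module,
i.e. a module over `Aᵐᵒᵖ`. -/
def dualEval (A : Type) [Ring A] (M : Type) [AddCommGroup M] [Module A M] (m : M) :
    (M →ₗ[A] A) →ₗ[Aᵐᵒᵖ] A where
  toFun f := f m
  map_add' _ _ := rfl
  map_smul' _ _ := rfl

variable (K : Type) [Field K]

/-- `V := ⊕_{i ∈ ℕ} K`, a countably infinite-dimensional `K`-vector space, regarded as a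
`(K × K, K × K)`-bimodule via `(x, y) • v = y • v` and `v • (x, y) = x • v`. -/
def VInf (K : Type) [Field K] : Type := ℕ →₀ K

instance : AddCommGroup (VInf K) := inferInstanceAs (AddCommGroup (ℕ →₀ K))

/-- left action: `(x, y) • v := y • v`. -/
instance : Module (K × K) (VInf K) := Module.compHom (ℕ →₀ K) (RingHom.snd K K)

/-- right action: `v • (x, y) := x • v`. -/
instance : Module (K × K)ᵐᵒᵖ (VInf K) :=
  Module.compHom (ℕ →₀ K) ((RingHom.fst K K).fromOpposite fun _ _ => mul_comm _ _)

instance : SMulCommClass (K × K) (K × K)ᵐᵒᵖ (VInf K) := by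
  constructor
  intro s r v
  let w : ℕ →₀ K := v
  show s.2 • ((MulOpposite.unop r).1 • w) = (MulOpposite.unop r).1 • (s.2 • w)
  exact smul_comm _ _ _

/-- `A`, the square-zero (trivial) extension of `K × K` by `V`:
`A = (K × K) ⊕ V` with `(s, v)(s', v') = (ss', s·v' + v·s')`. -/
def TrivExt (K : Type) [Field K] : Type := TrivSqZeroExt (K × K) (VInf K)

instance : Ring (TrivExt K) := TrivSqZeroExt.ring

/-- the idempotent `e = ((1, 0), 0)`. -/
def idem (K : Type) [Field K] : TrivExt K := TrivSqZeroExt.inl ((1, 0) : K × K)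

/-- `P = A e`, the indecomposable projective non-simple left `A`-module. -/
def Pmod (K : Type) [Field K] : Submodule (TrivExt K) (TrivExt K) :=
  Submodule.span (TrivExt K) {idem K}

/-- `rad(A)·e = {0} ⊕ V`, the maximal submodule of `P`. -/
def Wmod (K : Type) [Field K] : Submodule (TrivExt K) (TrivExt K) where
  carrier := {x | TrivSqZeroExt.fst x = 0}
  add_mem' := by
    intro a b ha hb
    have h : TrivSqZeroExt.fst (a + b)
        = TrivSqZeroExt.fst a + TrivSqZeroExt.fst b := rfl
    simp only [Set.mem_setOf_eq] at *
    rw [h, ha, hb, add_zero]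
  zero_mem' := rfl
  smul_mem' := by
    intro a x hx
    have h : TrivSqZeroExt.fst (a • x)
        = TrivSqZeroExt.fst a * TrivSqZeroExt.fst x := rfl
    simp only [Set.mem_setOf_eq] at *
    rw [h, hx, mul_zero]

/-- The left ideal generated by an idempotent is reflexive with respect to the regular
bimodule. -/
theorem bijective_dualEval_span_of_isIdempotentElem {A : Type} [Ring A] {e : A}
    (he : IsIdempotentElem e) :
    Function.Bijective (dualEval A (Submodule.span A {e})) := by
  let P := Submodule.span A {e}
  have mem_mul {m : A} (hm : m ∈ P) : m * e = m := by
    obtain ⟨a, rfl⟩ := Submodule.mem_span_singleton.mp hm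
    rw [smul_eq_mul, mul_assoc, he.eq]
  let e' : P := ⟨e, Submodule.mem_span_singleton_self e⟩
  refine ⟨fun m n h ↦ Subtype.ext (DFunLike.congr_fun h P.subtype), fun φ ↦ ?_⟩
  have subtype_smul (f : P →ₗ[A] A) : MulOpposite.op (f e') • P.subtype = f := by
    ext m
    calc (m : A) * f e' = f ((m : A) • e') := (map_smul f (m : A) e').symm
      _ = f m := congrArg f (Subtype.ext (mem_mul m.2))
  have map_eq (f : P →ₗ[A] A) : φ f = φ P.subtype * f e' := by
    conv_lhs => rw [← subtype_smul f]
    exact map_smul φ _ _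
  refine ⟨φ P.subtype • e', ?_⟩
  ext f
  exact (map_smul f (φ P.subtype) e').trans (map_eq f).symm

/-- On an infinite-dimensional space, some linear functional on the endomorphisms vanishes on
those of rank at most one but not at the identity. -/
theorem exists_linearMap_smulRight_eq_zero_and_id_ne_zero {V : Type*} [AddCommGroup V]
    [Module K V] (hV : ¬ Module.Finite K V) :
    ∃ l : (V →ₗ[K] V) →ₗ[K] K,
      (∀ (y : V →ₗ[K] K) (v : V), l (y.smulRight v) = 0) ∧ l LinearMap.id ≠ 0 := by
  have hid : (LinearMap.id : V →ₗ[K] V) ∉ LinearMap.finiteRange K V V := by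
    intro h
    have h' : (LinearMap.id : V →ₗ[K] V).range.FG :=
      LinearMap.HasNoetherianRange.hasFiniteRange h
    rw [LinearMap.range_id] at h'
    exact hV ⟨h'⟩
  obtain ⟨l, hl, hker⟩ := Submodule.exists_le_ker_of_notMem hid
  refine ⟨l, fun y v ↦ hker ?_, hl⟩
  have h : (LinearMap.toSpanSingleton K V v ∘ₗ y).HasNoetherianRange :=
    LinearMap.HasNoetherianRange.of_isNoetherian_rng.comp_left _
  exact h

/-- The inclusion of `V` into the submodule `{0} ⊕ V` of the square-zero extension. -/
def Wmod.mk (v : ℕ →₀ K) : Wmod K := ⟨TrivSqZeroExt.inr (v : VInf K), rfl⟩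

theorem Wmod.mk_add (v w : ℕ →₀ K) : Wmod.mk K (v + w) = Wmod.mk K v + Wmod.mk K w :=
  Subtype.ext (TrivSqZeroExt.inr_add _ _ _)

/-- The diagonal embedding of `K` into the square-zero extension. -/
def TrivExt.diag (c : K) : TrivExt K := TrivSqZeroExt.inl ((c, c) : K × K)

theorem Wmod.mk_smul (c : K) (v : ℕ →₀ K) :
    Wmod.mk K (c • v) = TrivExt.diag K c • Wmod.mk K v :=
  Subtype.ext (TrivSqZeroExt.inl_mul_inr (M := VInf K) (c, c) v).symm

variable {K}

theorem TrivExt.snd_mul_apply (a b : TrivExt K) :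
    (TrivSqZeroExt.snd (a * b) : ℕ →₀ K) =
      (TrivSqZeroExt.fst a).2 • (TrivSqZeroExt.snd b : ℕ →₀ K) +
        (TrivSqZeroExt.fst b).1 • (TrivSqZeroExt.snd a : ℕ →₀ K) :=
  rfl

/-- The endomorphism of `V` given by the `V`-component of a homomorphism `{0} ⊕ V → A`. -/
def Wmod.sndEnd (f : Wmod K →ₗ[TrivExt K] TrivExt K) : (ℕ →₀ K) →ₗ[K] (ℕ →₀ K) where
  toFun v := (TrivSqZeroExt.snd (f (Wmod.mk K v)) : VInf K)
  map_add' v w := by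
    rw [Wmod.mk_add, map_add]
    rfl
  map_smul' c v := by
    rw [Wmod.mk_smul, map_smul]
    refine (TrivExt.snd_mul_apply _ _).trans ?_
    exact (congrArg _ (smul_zero (A := ℕ →₀ K) _)).trans (add_zero _)

/-- The functional on `V` given by the second scalar component of a homomorphism
`{0} ⊕ V → A`. -/
def Wmod.fstDual (f : Wmod K →ₗ[TrivExt K] TrivExt K) : (ℕ →₀ K) →ₗ[K] K where
  toFun v := (TrivSqZeroExt.fst (f (Wmod.mk K v))).2
  map_add' v w := by
    rw [Wmod.mk_add, map_add]
    rfl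
  map_smul' c v := by
    rw [Wmod.mk_smul, map_smul]
    rfl

theorem Wmod.sndEnd_smul (a : (TrivExt K)ᵐᵒᵖ) (f : Wmod K →ₗ[TrivExt K] TrivExt K) :
    Wmod.sndEnd (a • f) =
      (Wmod.fstDual f).smulRight (TrivSqZeroExt.snd a.unop : ℕ →₀ K) +
        (TrivSqZeroExt.fst a.unop).1 • Wmod.sndEnd f :=
  LinearMap.ext fun v ↦ TrivExt.snd_mul_apply (f (Wmod.mk K v)) a.unop

/-- A functional on the endomorphisms of `V` vanishing on those of rank at most one induces an
element of the double dual of `{0} ⊕ V`. -/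
def Wmod.doubleDualOf (l : ((ℕ →₀ K) →ₗ[K] (ℕ →₀ K)) →ₗ[K] K)
    (hl : ∀ (y : (ℕ →₀ K) →ₗ[K] K) (v : ℕ →₀ K), l (y.smulRight v) = 0) :
    (Wmod K →ₗ[TrivExt K] TrivExt K) →ₗ[(TrivExt K)ᵐᵒᵖ] TrivExt K where
  toFun f := TrivSqZeroExt.inl ((l (Wmod.sndEnd f), 0) : K × K)
  map_add' f g := by
    have h : Wmod.sndEnd (f + g) = Wmod.sndEnd f + Wmod.sndEnd g := rfl
    rw [h, map_add]
    refine TrivSqZeroExt.ext (Prod.ext rfl (add_zero _).symm) (add_zero _).symm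
  map_smul' a f := by
    rw [Wmod.sndEnd_smul, map_add, hl, zero_add, map_smul]
    refine TrivSqZeroExt.ext (Prod.ext (mul_comm _ _) (zero_mul _).symm) ?_
    refine Eq.trans ?_ (TrivExt.snd_mul_apply _ _).symm
    exact ((congrArg₂ (· + ·) (zero_smul K (TrivSqZeroExt.snd a.unop : ℕ →₀ K))
      (smul_zero (A := ℕ →₀ K) _)).trans (add_zero _)).symm

variable (K)

theorem not_surjective_dualEval_Wmod :
    ¬ Function.Surjective (dualEval (TrivExt K) (Wmod K)) := by
  intro h
  obtain ⟨l, hl, hid⟩ := exists_linearMap_smulRight_eq_zero_and_id_ne_zero K (V := ℕ →₀ K)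
    (by
      rw [Module.finite_finsupp_self_iff, not_or]
      exact ⟨not_subsingleton K, not_finite_iff_infinite.mpr inferInstance⟩)
  obtain ⟨m, hm⟩ := h (Wmod.doubleDualOf l hl)
  have hm' : (m : TrivExt K) =
      TrivSqZeroExt.inl ((l (Wmod.sndEnd (Wmod K).subtype), 0) : K × K) :=
    DFunLike.congr_fun hm (Wmod K).subtype
  exact hid (congrArg (fun x : TrivExt K ↦ (TrivSqZeroExt.fst x).1) hm' |>.symm.trans
    (congrArg Prod.fst m.2))

theorem isIdempotentElem_idem : IsIdempotentElem (idem K) :=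
  (TrivSqZeroExt.inl_mul_inl (M := VInf K) _ _).trans
    (congrArg _ (Prod.ext (mul_one _) (mul_zero _)))

theorem Wmod_lt_Pmod : Wmod K < Pmod K := by
  refine lt_of_le_of_ne (fun x hx ↦ ?_) fun h ↦ ?_
  · refine Submodule.mem_span_singleton.mpr ⟨x, ?_⟩
    have hx' : TrivSqZeroExt.fst x = 0 := hx
    refine TrivSqZeroExt.ext ?_ ?_
    · exact (congrArg (· * _) hx').trans ((zero_mul _).trans hx'.symm)
    · refine (TrivExt.snd_mul_apply x (idem K)).trans ?_
      exact (congrArg₂ (· + ·) (smul_zero (A := ℕ →₀ K) _)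
        (one_smul K (TrivSqZeroExt.snd x : ℕ →₀ K))).trans (zero_add _)
  · have he : idem K ∈ Wmod K := h ▸ Submodule.mem_span_singleton_self _
    exact one_ne_zero (α := K) (congrArg Prod.fst (show ((1, 0) : K × K) = 0 from he))

/-- Over the square-zero extension `A` of `K × K` by the countably
infinite-dimensional bimodule `V` (the "generalized Kronecker" situation), the
indecomposable projective non-simple module `P = A e` is reflexive with respect to the
regular bimodule, but its maximal submodule `rad(A)·e = {0} ⊕ V` is not reflexive.
In particular, reflexive modules with respect to the faithfully balanced bimodule `A`
over itself are not closed under submodules. -/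
theorem reflexive_not_closed_under_submodules :
    Function.Bijective (fun m : Pmod K => dualEval (TrivExt K) (Pmod K) m) ∧
      Wmod K < Pmod K ∧
      ¬ Function.Bijective (fun m : Wmod K => dualEval (TrivExt K) (Wmod K) m) := by
  exact ⟨bijective_dualEval_span_of_isIdempotentElem (isIdempotentElem_idem K),
    Wmod_lt_Pmod K, fun h ↦ not_surjective_dualEval_Wmod K h.2⟩
end
end
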